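/- The expected discrepancy at blue-draw times satisfies lim_{n→∞} E[𝔇_{τ_n^𝔅}]/√n = 0. -/

import Mathlib

open MeasureTheory ProbabilityTheory Filter

/-- The asymptotic condition `1/w(n) = n^α (1 + 2B/n + O(1/n²))` on the weight function. -/
def WeightAsymp (w : ℕ → ℝ) (α B : ℝ) : Prop :=
  ∃ C₀ > (0:ℝ), ∃ N₀ : ℕ, ∀ n : ℕ, N₀ ≤ n →
    |1 / w n - (n:ℝ) ^ α - 2 * B * (n:ℝ) ^ (α - 1)| ≤ C₀ * (n:ℝ) ^ (α - 2)

/-- The three admissible choices of `(b, r)` in terms of the weight function `w`. -/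
def UrnChoice (w b r : ℕ → ℝ) : Prop :=
  (∀ i, b i = w (2*i) ∧ r i = w (2*i+1)) ∨
  (∀ i, b i = w (2*i+1) ∧ r i = w (2*i)) ∨
  (∀ i, b i = w (2*i) ∧ r i = w (2*i))

/-- A generalized Pólya urn process: `Bl n` and `Re n` are the numbers of blue and red
balls drawn in the first `n` draws; started at `(0,0)`, exactly one coordinate increases
by `1` at each step, and conditionally on the past the blue coordinate increases with
probability `b(Bl n)/(b(Bl n) + r(Re n))`. -/
structure Urn {Ω : Type*} [MeasurableSpace Ω] (μ : Measure Ω) (b r : ℕ → ℝ) where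
  Bl : ℕ → Ω → ℕ
  Re : ℕ → Ω → ℕ
  meas_Bl : ∀ n, Measurable (Bl n)
  meas_Re : ∀ n, Measurable (Re n)
  init_Bl : ∀ ω, Bl 0 ω = 0
  init_Re : ∀ ω, Re 0 ω = 0
  step : ∀ n ω, (Bl (n+1) ω = Bl n ω + 1 ∧ Re (n+1) ω = Re n ω) ∨
                (Bl (n+1) ω = Bl n ω ∧ Re (n+1) ω = Re n ω + 1)
  markov : ∀ n : ℕ,
    μ[(fun ω => if Bl (n+1) ω = Bl n ω + 1 then (1:ℝ) else 0) |
        ⨆ j ∈ Set.Iic n, MeasurableSpace.comap (fun ω => (Bl j ω, Re j ω)) inferInstance]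
      =ᵐ[μ] fun ω => b (Bl n ω) / (b (Bl n ω) + r (Re n ω))

namespace Urn

variable {Ω : Type*} [MeasurableSpace Ω] {μ : Measure Ω} {b r : ℕ → ℝ}

/-- The discrepancy `𝔇_n = ℜ_n − 𝔅_n`. -/
def D (U : Urn μ b r) (n : ℕ) (ω : Ω) : ℤ := (U.Re n ω : ℤ) - (U.Bl n ω : ℤ)

/-- `τ_k^𝔅`, the number of draws until the `k`-th blue ball. -/
noncomputable def tau (U : Urn μ b r) : ℕ → Ω → ℕ
  | 0 => fun _ => 0
  | k+1 => fun ω => sInf {n : ℕ | U.tau k ω < n ∧ U.Bl n ω = U.Bl (n-1) ω + 1}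

/-- The natural filtration `ℱ_n = σ((𝔅_j, ℜ_j), j ≤ n)`. -/
def F (U : Urn μ b r) (n : ℕ) : MeasurableSpace Ω :=
  ⨆ j ∈ Set.Iic n, MeasurableSpace.comap (fun ω => (U.Bl j ω, U.Re j ω)) inferInstance

end Urn

/-- The partial sums `∑_{k < m} 1 / v k`. -/
noncomputable def invSum (v : ℕ → ℝ) (m : ℕ) : ℝ := ∑ k ∈ Finset.range m, (v k)⁻¹

/-- The partial sums `∑_{k < m} 1 / (v k)²`. -/
noncomputable def invSqSum (v : ℕ → ℝ) (m : ℕ) : ℝ := ∑ k ∈ Finset.range m, ((v k)⁻¹) ^ 2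

lemma invSqSum_nonneg (v : ℕ → ℝ) (m : ℕ) : 0 ≤ invSqSum v m :=
  Finset.sum_nonneg fun _ _ => sq_nonneg _

lemma invSqSum_mono (v : ℕ → ℝ) : Monotone (invSqSum v) := fun _ _ h =>
  Finset.sum_le_sum_of_subset_of_nonneg (Finset.range_mono h) fun _ _ _ => sq_nonneg _

lemma invSum_nonneg {v : ℕ → ℝ} (hv : ∀ i, 0 < v i) (m : ℕ) : 0 ≤ invSum v m :=
  Finset.sum_nonneg fun k _ => (inv_pos.2 (hv k)).le

lemma invSum_mono {v : ℕ → ℝ} (hv : ∀ i, 0 < v i) : Monotone (invSum v) := fun _ _ h =>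
  Finset.sum_le_sum_of_subset_of_nonneg (Finset.range_mono h) fun k _ _ => (inv_pos.2 (hv k)).le

namespace Urn

variable {Ω : Type*} [MeasurableSpace Ω] {μ : Measure Ω} {b r : ℕ → ℝ}

lemma monotone_Bl (U : Urn μ b r) (ω : Ω) : Monotone fun n => U.Bl n ω :=
  monotone_nat_of_le_succ fun n => by
    rcases U.step n ω with h | h <;> simp [h.1]

lemma monotone_Re (U : Urn μ b r) (ω : Ω) : Monotone fun n => U.Re n ω :=
  monotone_nat_of_le_succ fun n => by
    rcases U.step n ω with h | h <;> simp [h.2]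

lemma Bl_add_Re (U : Urn μ b r) (n : ℕ) (ω : Ω) : U.Bl n ω + U.Re n ω = n := by
  induction n with
  | zero => simp [U.init_Bl, U.init_Re]
  | succ n ih => rcases U.step n ω with h | h <;> omega

lemma tau_spec (U : Urn μ b r) (n : ℕ) (ω : Ω) (h : ∃ N, n ≤ U.Bl N ω) :
    U.Bl (U.tau n ω) ω = n ∧ ∀ N < U.tau n ω, U.Bl N ω < n := by
  induction n with
  | zero => simp [tau, U.init_Bl]
  | succ n ih =>
    obtain ⟨hB, hlt⟩ := ih (h.imp fun N hN => by omega)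
    classical
    have hm := Nat.find_spec h
    have hmin : ∀ N < Nat.find h, U.Bl N ω < n + 1 := fun N hN => by
      have := Nat.find_min h hN; omega
    set m := Nat.find h
    have htm : U.tau n ω < m := by
      by_contra hc
      have := U.monotone_Bl ω (not_lt.1 hc)
      simp only at this
      omega
    have hm1 : m - 1 + 1 = m := by omega
    have hprev := hmin (m - 1) (by omega)
    have hstep := U.step (m - 1) ω
    rw [hm1] at hstep
    have hBm : U.Bl m ω = U.Bl (m - 1) ω + 1 := by
      rcases hstep with h | h <;> omega
    have hmem : m ∈ {k | U.tau n ω < k ∧ U.Bl k ω = U.Bl (k - 1) ω + 1} := ⟨htm, hBm⟩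
    have htau : U.tau (n + 1) ω = m := by
      apply le_antisymm (Nat.sInf_le hmem)
      apply le_csInf (Set.nonempty_of_mem hmem)
      rintro k ⟨hk, hBk⟩
      by_contra hc
      have h1 := hmin k (not_le.1 hc)
      have h2 := U.monotone_Bl ω (show U.tau n ω ≤ k - 1 by omega)
      simp only at h2
      omega
    rw [htau]
    exact ⟨by omega, hmin⟩

/-- The red count frozen at the first time the blue count reaches `n`. -/
def stoppedRe (U : Urn μ b r) (n : ℕ) : ℕ → Ω → ℕ
  | 0 => fun _ => 0
  | N + 1 => fun ω => if U.Bl N ω < n then U.Re (N + 1) ω else U.stoppedRe n N ω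

/-- The blue count frozen at the first time it reaches `n`. -/
def stoppedBl (U : Urn μ b r) (n N : ℕ) (ω : Ω) : ℕ := min (U.Bl N ω) n

lemma measurable_stoppedRe (U : Urn μ b r) (n N : ℕ) : Measurable (U.stoppedRe n N) := by
  induction N with
  | zero => exact measurable_const
  | succ N ih =>
    exact Measurable.ite (measurableSet_lt (U.meas_Bl N) measurable_const) (U.meas_Re _) ih

lemma measurable_stoppedBl (U : Urn μ b r) (n N : ℕ) : Measurable (U.stoppedBl n N) :=
  (U.meas_Bl N).min measurable_const

lemma stoppedRe_le (U : Urn μ b r) (n N : ℕ) (ω : Ω) : U.stoppedRe n N ω ≤ N := by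
  induction N with
  | zero => simp [stoppedRe]
  | succ N ih =>
    have := U.Bl_add_Re (N + 1) ω
    simp only [stoppedRe]
    split_ifs <;> omega

lemma stoppedRe_of_lt (U : Urn μ b r) {n N : ℕ} {ω : Ω} (h : U.Bl N ω < n) :
    U.stoppedRe n N ω = U.Re N ω := by
  cases N with
  | zero => simp [stoppedRe, U.init_Re]
  | succ N =>
    have := U.monotone_Bl ω (Nat.le_succ N)
    simp only [Nat.succ_eq_add_one] at this
    simp only [stoppedRe]
    rw [if_pos (by omega)]

lemma stoppedRe_of_tau_le (U : Urn μ b r) {n N : ℕ} {ω : Ω} (h : ∃ N, n ≤ U.Bl N ω)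
    (hN : U.tau n ω ≤ N) : U.stoppedRe n N ω = U.Re (U.tau n ω) ω := by
  obtain ⟨hB, hlt⟩ := U.tau_spec n ω h
  induction N, hN using Nat.le_induction with
  | base =>
    rcases ht : U.tau n ω with _ | t
    · simp [stoppedRe, U.init_Re]
    · simp only [stoppedRe]
      rw [if_pos (hlt t (by omega))]
  | succ N hN ih =>
    have := U.monotone_Bl ω hN
    simp only at this
    simp only [stoppedRe]
    rw [if_neg (by omega), ih]

lemma stoppedBl_of_tau_le (U : Urn μ b r) {n N : ℕ} {ω : Ω} (h : ∃ N, n ≤ U.Bl N ω)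
    (hN : U.tau n ω ≤ N) : U.stoppedBl n N ω = n := by
  have := U.monotone_Bl ω hN
  have h2 := (U.tau_spec n ω h).1
  simp only at this
  simp only [stoppedBl]
  omega

lemma integrable_of_bounded_nat [IsFiniteMeasure μ] (f : ℕ → ℕ → ℝ) (X Y : Ω → ℕ) (N : ℕ)
    (hX : Measurable X) (hY : Measurable Y) (hXN : ∀ ω, X ω ≤ N) (hYN : ∀ ω, Y ω ≤ N) :
    Integrable (fun ω => f (X ω) (Y ω)) μ := by
  have hm : Measurable fun ω => f (X ω) (Y ω) :=
    (measurable_of_countable (fun p : ℕ × ℕ => f p.1 p.2)).comp (hX.prodMk hY)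
  refine Integrable.of_bound hm.aestronglyMeasurable
    (∑ i ∈ Finset.range (N + 1), ∑ j ∈ Finset.range (N + 1), |f i j|) (ae_of_all _ fun ω => ?_)
  have h1 : |f (X ω) (Y ω)| ≤ ∑ j ∈ Finset.range (N + 1), |f (X ω) j| :=
    Finset.single_le_sum (f := fun j => |f (X ω) j|) (fun _ _ => abs_nonneg _)
      (Finset.mem_range.2 (Nat.lt_succ_of_le (hYN ω)))
  have h2 := Finset.single_le_sum (f := fun i => ∑ j ∈ Finset.range (N + 1), |f i j|)
      (fun _ _ => Finset.sum_nonneg fun _ _ => abs_nonneg _)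
      (Finset.mem_range.2 (Nat.lt_succ_of_le (hXN ω)))
  exact h1.trans h2

lemma F_le (U : Urn μ b r) (n : ℕ) : U.F n ≤ ‹MeasurableSpace Ω› :=
  iSup₂_le fun j _ => ((U.meas_Bl j).prodMk (U.meas_Re j)).comap_le

lemma integral_blue_mul [IsProbabilityMeasure μ] (U : Urn μ b r) (N : ℕ) (g : ℕ → ℕ → ℝ) :
    ∫ ω, (if U.Bl (N + 1) ω = U.Bl N ω + 1 then (1 : ℝ) else 0) * g (U.Bl N ω) (U.Re N ω) ∂μ =
      ∫ ω, b (U.Bl N ω) / (b (U.Bl N ω) + r (U.Re N ω)) * g (U.Bl N ω) (U.Re N ω) ∂μ := by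
  have hF := U.F_le N
  have hZ : Measurable[U.F N] fun ω => (U.Bl N ω, U.Re N ω) := by
    rw [measurable_iff_comap_le]
    exact le_iSup₂_of_le (f := fun j (_ : j ∈ Set.Iic N) =>
      MeasurableSpace.comap (fun ω => (U.Bl j ω, U.Re j ω)) inferInstance) N Set.self_mem_Iic le_rfl
  have hg : StronglyMeasurable[U.F N] fun ω => g (U.Bl N ω) (U.Re N ω) :=
    ((measurable_of_countable (fun p : ℕ × ℕ => g p.1 p.2)).comp hZ).stronglyMeasurable
  have hB : ∀ ω, U.Bl N ω ≤ N := fun ω => by have := U.Bl_add_Re N ω; omega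
  have hR : ∀ ω, U.Re N ω ≤ N := fun ω => by have := U.Bl_add_Re N ω; omega
  have hB' : ∀ ω, U.Bl (N + 1) ω ≤ N + 1 := fun ω => by have := U.Bl_add_Re (N + 1) ω; omega
  have hi : Integrable (fun ω => if U.Bl (N + 1) ω = U.Bl N ω + 1 then (1 : ℝ) else 0) μ :=
    integrable_of_bounded_nat (fun i j => if i = j + 1 then (1 : ℝ) else 0) _ _ (N + 1)
      (U.meas_Bl _) (U.meas_Bl _) hB' fun ω => (hB ω).trans (Nat.le_succ _)
  have hgi : Integrable (fun ω => g (U.Bl N ω) (U.Re N ω)) μ :=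
    integrable_of_bounded_nat g _ _ N (U.meas_Bl _) (U.meas_Re _) hB hR
  have hprod : Integrable ((fun ω => if U.Bl (N + 1) ω = U.Bl N ω + 1 then (1 : ℝ) else 0) *
      fun ω => g (U.Bl N ω) (U.Re N ω)) μ := by
    refine hgi.mono (hi.aestronglyMeasurable.mul hgi.aestronglyMeasurable) (ae_of_all _ fun ω => ?_)
    simp only [Pi.mul_apply]
    split_ifs <;> simp
  have hpull := condExp_mul_of_stronglyMeasurable_right hg hprod hi
  have hint := integral_condExp hF (f := (fun ω => if U.Bl (N + 1) ω = U.Bl N ω + 1 then (1 : ℝ)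
    else 0) * fun ω => g (U.Bl N ω) (U.Re N ω)) (μ := μ)
  refine hint.symm.trans (integral_congr_ae ?_)
  filter_upwards [hpull, U.markov N] with ω h1 h2
  rw [h1]
  simp only [Pi.mul_apply]
  exact congrArg (· * g (U.Bl N ω) (U.Re N ω)) h2

lemma integral_stopped_of_harmonic [IsProbabilityMeasure μ] (U : Urn μ b r) (n : ℕ)
    (hb : ∀ i, 0 < b i) (hr : ∀ i, 0 < r i) (f : ℕ → ℕ → ℝ)
    (hf : ∀ i j, b i * (f (i + 1) j - f i j) + r j * (f i (j + 1) - f i j) = 0) (N : ℕ) :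
    ∫ ω, f (U.stoppedBl n N ω) (U.stoppedRe n N ω) ∂μ = f 0 0 := by
  have hBN : ∀ N ω, U.Bl N ω ≤ N := fun N ω => by have := U.Bl_add_Re N ω; omega
  have hRN : ∀ N ω, U.Re N ω ≤ N := fun N ω => by have := U.Bl_add_Re N ω; omega
  have hint : ∀ N, Integrable (fun ω => f (U.stoppedBl n N ω) (U.stoppedRe n N ω)) μ := fun N =>
    integrable_of_bounded_nat f _ _ N (U.measurable_stoppedBl n N) (U.measurable_stoppedRe n N)
      (fun ω => (min_le_left _ _).trans (hBN N ω)) (U.stoppedRe_le n N)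
  induction N with
  | zero => simp [stoppedBl, stoppedRe, U.init_Bl]
  | succ N ih =>
    rw [← ih, ← sub_eq_zero, ← integral_sub (hint _) (hint _)]
    set g : ℕ → ℕ → ℝ := fun i j => if i < n then f (i + 1) j - f i (j + 1) else 0 with hg
    set h : ℕ → ℕ → ℝ := fun i j => if i < n then f i (j + 1) - f i j else 0 with hh
    have hpt : ∀ ω, f (U.stoppedBl n (N + 1) ω) (U.stoppedRe n (N + 1) ω) -
        f (U.stoppedBl n N ω) (U.stoppedRe n N ω) =
        (if U.Bl (N + 1) ω = U.Bl N ω + 1 then (1 : ℝ) else 0) * g (U.Bl N ω) (U.Re N ω) +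
          h (U.Bl N ω) (U.Re N ω) := by
      intro ω
      by_cases hlt : U.Bl N ω < n
      · rw [U.stoppedRe_of_lt hlt]
        simp only [stoppedRe, stoppedBl, hg, hh, if_pos hlt]
        rcases U.step N ω with ⟨h1, h2⟩ | ⟨h1, h2⟩
        · rw [h1, h2, min_eq_left (by omega), min_eq_left (by omega), if_pos rfl]; ring
        · rw [h1, h2, min_eq_left (by omega), if_neg (by omega)]; ring
      · have := U.monotone_Bl ω (Nat.le_succ N)
        simp only [Nat.succ_eq_add_one] at this
        simp only [stoppedRe, stoppedBl, hg, hh, if_neg hlt]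
        rw [min_eq_right (by omega), min_eq_right (by omega)]; ring
    have hig : ∀ g : ℕ → ℕ → ℝ, Integrable (fun ω => g (U.Bl N ω) (U.Re N ω)) μ := fun g =>
      integrable_of_bounded_nat g _ _ N (U.meas_Bl _) (U.meas_Re _) (hBN N) (hRN N)
    have hiblue : Integrable (fun ω => (if U.Bl (N + 1) ω = U.Bl N ω + 1 then (1 : ℝ) else 0) *
        g (U.Bl N ω) (U.Re N ω)) μ := by
      have := ((hint (N + 1)).sub (hint N)).sub (hig h)
      refine this.congr (ae_of_all _ fun ω => ?_)
      simp only [Pi.sub_apply, hpt]; ring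
    simp_rw [hpt]
    rw [integral_add hiblue (hig h), U.integral_blue_mul N g,
      ← integral_add (hig fun i j => b i / (b i + r j) * g i j) (hig h)]
    refine integral_eq_zero_of_ae (ae_of_all _ fun ω => ?_)
    simp only [hg, hh, Pi.zero_apply]
    split_ifs
    · have h1 := hb (U.Bl N ω)
      have h2 := hr (U.Re N ω)
      have := hf (U.Bl N ω) (U.Re N ω)
      field_simp
      linarith
    · simp

end Urn

namespace Urn

variable {Ω : Type*} [MeasurableSpace Ω] {μ : Measure Ω} {b r : ℕ → ℝ}

lemma integrable_stopped [IsProbabilityMeasure μ] (U : Urn μ b r) (f : ℕ → ℕ → ℝ) (n N : ℕ) :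
    Integrable (fun ω => f (U.stoppedBl n N ω) (U.stoppedRe n N ω)) μ :=
  integrable_of_bounded_nat f _ _ N (U.measurable_stoppedBl n N) (U.measurable_stoppedRe n N)
    (fun ω => (min_le_left _ _).trans (by have := U.Bl_add_Re N ω; omega)) (U.stoppedRe_le n N)

lemma integral_stopped_invSum_sub [IsProbabilityMeasure μ] (U : Urn μ b r) (n : ℕ)
    (hb : ∀ i, 0 < b i) (hr : ∀ i, 0 < r i) (N : ℕ) :
    ∫ ω, (invSum r (U.stoppedRe n N ω) - invSum b (U.stoppedBl n N ω)) ∂μ = 0 := by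
  have := U.integral_stopped_of_harmonic n hb hr (fun i j => invSum r j - invSum b i)
    (fun i j => by
      have h1 := (hb i).ne'
      have h2 := (hr j).ne'
      simp only [invSum, Finset.sum_range_succ]
      field_simp
      ring) N
  simpa [invSum] using this

lemma integral_stopped_invSum_sub_sq [IsProbabilityMeasure μ] (U : Urn μ b r) (n : ℕ)
    (hb : ∀ i, 0 < b i) (hr : ∀ i, 0 < r i) (N : ℕ) :
    ∫ ω, (invSum r (U.stoppedRe n N ω) - invSum b (U.stoppedBl n N ω)) ^ 2 ∂μ =
      ∫ ω, invSqSum r (U.stoppedRe n N ω) ∂μ + ∫ ω, invSqSum b (U.stoppedBl n N ω) ∂μ := by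
  have := U.integral_stopped_of_harmonic n hb hr
    (fun i j => (invSum r j - invSum b i) ^ 2 - (invSqSum r j + invSqSum b i))
    (fun i j => by
      have h1 := (hb i).ne'
      have h2 := (hr j).ne'
      simp only [invSum, invSqSum, Finset.sum_range_succ]
      field_simp
      ring) N
  rw [integral_sub (U.integrable_stopped (fun i j => (invSum r j - invSum b i) ^ 2) n N)
    (U.integrable_stopped (fun i j => invSqSum r j + invSqSum b i) n N),
    integral_add (U.integrable_stopped (fun i j => invSqSum r j) n N)
    (U.integrable_stopped (fun i j => invSqSum b i) n N)] at this
  simp only [invSum, invSqSum, Finset.range_zero, Finset.sum_empty] at this ⊢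
  linarith

lemma integral_stopped_invSqSum_le [IsProbabilityMeasure μ] (U : Urn μ b r) (n : ℕ)
    (hb : ∀ i, 0 < b i) (hr : ∀ i, 0 < r i) {K : ℝ}
    (hK : ∀ m, ∀ i ≤ n, 2 * invSqSum r m - K ≤ (invSum r m - invSum b i) ^ 2) (N : ℕ) :
    ∫ ω, invSqSum r (U.stoppedRe n N ω) ∂μ ≤ K + invSqSum b n ∧
    ∫ ω, (invSum r (U.stoppedRe n N ω) - invSum b (U.stoppedBl n N ω)) ^ 2 ∂μ ≤
      K + 2 * invSqSum b n := by
  have h1 := U.integral_stopped_invSum_sub_sq n hb hr N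
  have h2 : ∫ ω, invSqSum b (U.stoppedBl n N ω) ∂μ ≤ ∫ _, invSqSum b n ∂μ :=
    integral_mono (U.integrable_stopped (fun i j => invSqSum b i) n N) (integrable_const _)
      fun ω => invSqSum_mono b (min_le_right _ _)
  have h3 : ∫ ω, (2 * invSqSum r (U.stoppedRe n N ω) - K) ∂μ ≤
      ∫ ω, (invSum r (U.stoppedRe n N ω) - invSum b (U.stoppedBl n N ω)) ^ 2 ∂μ :=
    integral_mono (U.integrable_stopped (fun i j => 2 * invSqSum r j - K) n N)
      (U.integrable_stopped (fun i j => (invSum r j - invSum b i) ^ 2) n N)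
      fun ω => hK _ _ (min_le_right _ _)
  rw [integral_sub ((U.integrable_stopped (fun i j => invSqSum r j) n N).const_mul 2)
    (integrable_const _), integral_const_mul] at h3
  simp only [integral_const, probReal_univ, one_smul] at h2 h3
  constructor <;> linarith

lemma ae_exists_le_Bl [IsProbabilityMeasure μ] (U : Urn μ b r) (n : ℕ)
    (hb : ∀ i, 0 < b i) (hr : ∀ i, 0 < r i) {K : ℝ}
    (hK : ∀ m, ∀ i ≤ n, 2 * invSqSum r m - K ≤ (invSum r m - invSum b i) ^ 2)
    (htop : Tendsto (invSqSum r) atTop atTop) :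
    ∀ᵐ ω ∂μ, ∃ N, n ≤ U.Bl N ω := by
  set A : Set Ω := {ω | ∀ N, U.Bl N ω < n} with hA
  have hAm : MeasurableSet A := by
    rw [hA, Set.ofPred_forall]
    exact MeasurableSet.iInter fun N => measurableSet_lt (U.meas_Bl N) measurable_const
  have hA0 : μ.real A = 0 := by
    by_contra hne
    have hpos : 0 < μ.real A := lt_of_le_of_ne measureReal_nonneg (Ne.symm hne)
    obtain ⟨m, hm⟩ := (htop.eventually_gt_atTop ((K + invSqSum b n) / μ.real A)).exists
    rw [div_lt_iff₀ hpos] at hm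
    have h1 := (U.integral_stopped_invSqSum_le n hb hr hK (m + n)).1
    have h2 : ∫ ω, A.indicator (fun _ => invSqSum r m) ω ∂μ ≤
        ∫ ω, invSqSum r (U.stoppedRe n (m + n) ω) ∂μ := by
      refine integral_mono ((integrable_const _).indicator hAm)
        (U.integrable_stopped (fun i j => invSqSum r j) n (m + n)) fun ω => ?_
      by_cases hω : ω ∈ A
      · simp only [Set.indicator_of_mem hω]
        apply invSqSum_mono r
        have h3 := hω (m + n)
        have h4 := U.Bl_add_Re (m + n) ω
        rw [U.stoppedRe_of_lt h3]
        omega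
      · simp only [Set.indicator_of_notMem hω]
        exact invSqSum_nonneg _ _
    rw [integral_indicator_const _ hAm, smul_eq_mul] at h2
    linarith [mul_comm (μ.real A) (invSqSum r m)]
  rw [measureReal_eq_zero_iff] at hA0
  rw [ae_iff]
  convert hA0 using 3
  simp

lemma moments_at_tau [IsProbabilityMeasure μ] (U : Urn μ b r) (n : ℕ)
    (hb : ∀ i, 0 < b i) (hr : ∀ i, 0 < r i) {K : ℝ}
    (hK : ∀ m, ∀ i ≤ n, 2 * invSqSum r m - K ≤ (invSum r m - invSum b i) ^ 2)
    (htop : Tendsto (invSqSum r) atTop atTop) :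
    AEStronglyMeasurable (fun ω => (U.Re (U.tau n ω) ω : ℝ)) μ ∧
    Integrable (fun ω => invSum r (U.Re (U.tau n ω) ω) - invSum b n) μ ∧
    ∫ ω, (invSum r (U.Re (U.tau n ω) ω) - invSum b n) ∂μ = 0 ∧
    Integrable (fun ω => (invSum r (U.Re (U.tau n ω) ω) - invSum b n) ^ 2) μ ∧
    ∫ ω, (invSum r (U.Re (U.tau n ω) ω) - invSum b n) ^ 2 ∂μ ≤ K + 2 * invSqSum b n := by
  have hae := U.ae_exists_le_Bl n hb hr hK htop
  have hconv : ∀ f : ℕ → ℕ → ℝ, ∀ᵐ ω ∂μ,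
      Tendsto (fun N => f (U.stoppedBl n N ω) (U.stoppedRe n N ω)) atTop
        (nhds (f n (U.Re (U.tau n ω) ω))) := fun f => by
    filter_upwards [hae] with ω hω
    refine tendsto_const_nhds.congr' ?_
    filter_upwards [eventually_ge_atTop (U.tau n ω)] with N hN
    rw [U.stoppedBl_of_tau_le hω hN, U.stoppedRe_of_tau_le hω hN]
  have hmeas : ∀ f : ℕ → ℕ → ℝ,
      AEStronglyMeasurable (fun ω => f n (U.Re (U.tau n ω) ω)) μ := fun f =>
    aestronglyMeasurable_of_tendsto_ae atTop
      (fun N => (U.integrable_stopped f n N).aestronglyMeasurable) (hconv f)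
  set C := K + 2 * invSqSum b n with hC
  have hMi := fun N => U.integrable_stopped (fun i j => (invSum r j - invSum b i) ^ 2) n N
  have hlint : ∫⁻ ω, ENNReal.ofReal ((invSum r (U.Re (U.tau n ω) ω) - invSum b n) ^ 2) ∂μ ≤
      ENNReal.ofReal C := by
    have h1 : ∀ N, ∫⁻ ω, ENNReal.ofReal ((invSum r (U.stoppedRe n N ω) -
        invSum b (U.stoppedBl n N ω)) ^ 2) ∂μ ≤ ENNReal.ofReal C := fun N => by
      rw [← ofReal_integral_eq_lintegral_ofReal (hMi N) (ae_of_all _ fun _ => sq_nonneg _)]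
      exact ENNReal.ofReal_le_ofReal (U.integral_stopped_invSqSum_le n hb hr hK N).2
    calc _ = ∫⁻ ω, liminf (fun N => ENNReal.ofReal ((invSum r (U.stoppedRe n N ω) -
        invSum b (U.stoppedBl n N ω)) ^ 2)) atTop ∂μ := by
          refine lintegral_congr_ae ?_
          filter_upwards [hconv fun i j => (invSum r j - invSum b i) ^ 2] with ω hω
          exact ((ENNReal.tendsto_ofReal hω).liminf_eq).symm
      _ ≤ liminf (fun N => ∫⁻ ω, ENNReal.ofReal ((invSum r (U.stoppedRe n N ω) -
        invSum b (U.stoppedBl n N ω)) ^ 2) ∂μ) atTop :=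
          lintegral_liminf_le' fun N => (hMi N).aestronglyMeasurable.aemeasurable.ennreal_ofReal
      _ ≤ ENNReal.ofReal C := by
          refine liminf_le_of_le (by isBoundedDefault) fun c hc => ?_
          obtain ⟨N, hN⟩ := hc.exists
          exact hN.trans (h1 N)
  have hsq : Integrable (fun ω => (invSum r (U.Re (U.tau n ω) ω) - invSum b n) ^ 2) μ := by
    refine ⟨hmeas fun i j => (invSum r j - invSum b i) ^ 2, ?_⟩
    rw [hasFiniteIntegral_iff_ofReal (ae_of_all _ fun _ => sq_nonneg _)]
    exact hlint.trans_lt ENNReal.ofReal_lt_top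
  have hsqle : ∫ ω, (invSum r (U.Re (U.tau n ω) ω) - invSum b n) ^ 2 ∂μ ≤ C := by
    have hC0 : 0 ≤ C := (integral_nonneg fun _ => sq_nonneg _).trans
      (U.integral_stopped_invSqSum_le n hb hr hK 0).2
    rw [integral_eq_lintegral_of_nonneg_ae (ae_of_all _ fun _ => sq_nonneg _)
      (hmeas fun i j => (invSum r j - invSum b i) ^ 2)]
    exact ENNReal.toReal_le_of_le_ofReal hC0 hlint
  have hint : Integrable (fun ω => invSum r (U.Re (U.tau n ω) ω) - invSum b n) μ := by
    refine (hsq.add (integrable_const 1)).mono' (hmeas fun i j => invSum r j - invSum b i)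
      (ae_of_all _ fun ω => ?_)
    simp only [Real.norm_eq_abs, Pi.add_apply]
    rw [abs_le]
    constructor <;> nlinarith [sq_nonneg (invSum r (U.Re (U.tau n ω) ω) - invSum b n - 1),
      sq_nonneg (invSum r (U.Re (U.tau n ω) ω) - invSum b n + 1)]
  refine ⟨hmeas fun i j => j, hint, ?_, hsq, hsqle⟩
  refine tendsto_nhds_unique (tendsto_integral_of_dominated_convergence
    (F := fun N ω => invSum r (U.stoppedRe n N ω) - invSum b (U.stoppedBl n N ω))
    (fun ω => |invSum r (U.Re (U.tau n ω) ω) - invSum b n| + 2 * invSum b n)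
    (fun N => (U.integrable_stopped (fun i j => invSum r j - invSum b i) n N).aestronglyMeasurable)
    (hint.abs.add (integrable_const _)) (fun N => ?_)
    (hconv fun i j => invSum r j - invSum b i)) ?_
  · filter_upwards [hae] with ω hω
    have h1 : U.stoppedRe n N ω ≤ U.Re (U.tau n ω) ω := by
      rcases le_total (U.tau n ω) N with h | h
      · rw [U.stoppedRe_of_tau_le hω h]
      · rcases h.lt_or_eq with h | h
        · rw [U.stoppedRe_of_lt ((U.tau_spec n ω hω).2 N h)]
          exact U.monotone_Re ω h.le
        · rw [U.stoppedRe_of_tau_le hω h.ge]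
    have h2 := invSum_mono hr h1
    have h3 := invSum_mono hb (min_le_right (U.Bl N ω) n)
    have h4 := invSum_nonneg hr (U.stoppedRe n N ω)
    have h5 := invSum_nonneg hb (U.stoppedBl n N ω)
    have h6 := invSum_nonneg hb n
    have h7 := le_abs_self (invSum r (U.Re (U.tau n ω) ω) - invSum b n)
    have h8 := abs_nonneg (invSum r (U.Re (U.tau n ω) ω) - invSum b n)
    change invSum b (U.stoppedBl n N ω) ≤ _ at h3
    rw [Real.norm_eq_abs, abs_le]
    constructor <;> linarith
  · simp only [U.integral_stopped_invSum_sub n hb hr]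
    exact tendsto_const_nhds

end Urn

lemma exists_forall_le_mul_of_eventually {f g : ℕ → ℝ} (hg : ∀ i, 0 < g i) {C : ℝ}
    (h : ∀ᶠ i in atTop, f i ≤ C * g i) : ∃ K > 0, ∀ i, f i ≤ K * g i := by
  have hb : IsBoundedUnder (· ≤ ·) atTop fun i => f i / g i := by
    refine isBoundedUnder_of_eventually_le (a := C) ?_
    filter_upwards [h] with i hi
    rwa [div_le_iff₀ (hg i)]
  obtain ⟨K, hK⟩ := hb.bddAbove_range
  refine ⟨max K 1, by positivity, fun i => ?_⟩
  have h1 : f i / g i ≤ max K 1 := (hK (Set.mem_range_self i)).trans (le_max_left _ _)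
  rwa [div_le_iff₀ (hg i)] at h1

/-- `1 / v k = c (k + 1) ^ α + O((k + 1) ^ (α - 1))`, with constant `C`. -/
def InvPowerGrowth (v : ℕ → ℝ) (α c C : ℝ) : Prop :=
  ∀ k : ℕ, |(v k)⁻¹ - c * ((k : ℝ) + 1) ^ α| ≤ C * ((k : ℝ) + 1) ^ (α - 1)

lemma InvPowerGrowth.mono {v : ℕ → ℝ} {α c C C' : ℝ} (h : InvPowerGrowth v α c C) (hC : C ≤ C') :
    InvPowerGrowth v α c C' := fun k =>
  (h k).trans (mul_le_mul_of_nonneg_right hC (by positivity))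

lemma WeightAsymp.invPowerGrowth {w : ℕ → ℝ} {α B : ℝ} (h : WeightAsymp w α B) (hα : 0 < α)
    (e : ℕ) (he : e ≤ 1) : ∃ C > 0, InvPowerGrowth (fun i => w (2 * i + e)) α (2 ^ α) C := by
  obtain ⟨C₀, hC₀, N₀, hN⟩ := h
  have hder : (fun t : ℝ => t ^ α - (1 : ℝ) ^ α) =O[nhds 1] fun t => t - 1 :=
    (Real.hasDerivAt_rpow_const (p := α) (Or.inl one_ne_zero)).isBigO_sub
  obtain ⟨A, hA⟩ := hder.bound
  have htend : Tendsto (fun i : ℕ => (((2 * i + e : ℕ) : ℝ)) / (2 * (i + 1))) atTop (nhds 1) := by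
    have h1 : Tendsto (fun i : ℕ => 1 - (1 - e / 2 : ℝ) * (1 / ((i : ℝ) + 1))) atTop
        (nhds (1 - (1 - e / 2 : ℝ) * 0)) :=
      tendsto_const_nhds.sub (tendsto_one_div_add_atTop_nhds_zero_nat.const_mul _)
    rw [mul_zero, sub_zero] at h1
    refine h1.congr fun i => ?_
    push_cast
    field_simp
    ring
  refine exists_forall_le_mul_of_eventually (C := ((2 * |B| + C₀) * 2 + 2 * |A|) * 2 ^ (α - 1))
    (fun i => by positivity) ?_
  filter_upwards [htend.eventually hA, eventually_ge_atTop (N₀ + 1)] with i hi hiN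
  set x : ℝ := ((2 * i + e : ℕ) : ℝ) with hx
  set y : ℝ := 2 * ((i : ℝ) + 1) with hy
  have hi1 : (1 : ℝ) ≤ i := by exact_mod_cast (by omega : 1 ≤ i)
  have hxe : x = 2 * i + e := by rw [hx]; push_cast; ring
  have he0 : (0 : ℝ) ≤ e := Nat.cast_nonneg e
  have he1 : (e : ℝ) ≤ 1 := by exact_mod_cast he
  have hy0 : 0 < y := by positivity
  have hx1 : 1 ≤ x := by linarith
  have hxy : x ≤ y := by rw [hxe, hy]; linarith
  have hyx : y ≤ 2 * x := by rw [hxe, hy]; linarith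
  have hw := hN (2 * i + e) (by omega)
  rw [← hx] at hw
  have hyα : y ^ α = 2 ^ α * ((i : ℝ) + 1) ^ α := Real.mul_rpow (by norm_num) (by positivity)
  have hyα1 : y ^ (α - 1) = 2 ^ (α - 1) * ((i : ℝ) + 1) ^ (α - 1) :=
    Real.mul_rpow (by norm_num) (by positivity)
  have hyz : 0 < y ^ (α - 1) := by positivity
  have hx0 : 0 < x := by linarith
  have hxα1 : x ^ (α - 1) ≤ 2 * y ^ (α - 1) := by
    rw [Real.rpow_sub_one hx0.ne', Real.rpow_sub_one hy0.ne', div_le_iff₀ hx0]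
    have h1 : x ^ α ≤ y ^ α := Real.rpow_le_rpow hx0.le hxy hα.le
    have h2 : y ^ α ≤ y ^ α * (2 * x / y) :=
      le_mul_of_one_le_right (by positivity) (by rwa [one_le_div hy0])
    calc x ^ α ≤ y ^ α * (2 * x / y) := h1.trans h2
      _ = _ := by ring
  have hxα2 : x ^ (α - 2) ≤ x ^ (α - 1) := Real.rpow_le_rpow_of_exponent_le hx1 (by linarith)
  have hxy1 : |x ^ α - y ^ α| ≤ 2 * |A| * y ^ (α - 1) := by
    rw [Real.one_rpow, Real.norm_eq_abs, Real.norm_eq_abs, Real.div_rpow hx0.le hy0.le,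
      div_sub_one hy0.ne', div_sub_one (by positivity), abs_div, abs_div,
      abs_of_pos (by positivity : 0 < y ^ α), abs_of_pos hy0, div_le_iff₀ (by positivity)] at hi
    have h1 : |x - y| ≤ 2 := by rw [abs_of_nonpos (by linarith), hxe, hy]; linarith
    calc |x ^ α - y ^ α| ≤ A * (|x - y| / y) * y ^ α := hi
      _ ≤ |A| * (2 / y) * y ^ α := by gcongr; exact le_abs_self A
      _ = _ := by rw [Real.rpow_sub_one hy0.ne']; ring
  have h1 : |(w (2 * i + e))⁻¹ - x ^ α| ≤ (2 * |B| + C₀) * (2 * y ^ (α - 1)) := by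
    rw [one_div] at hw
    have h2 : |2 * B * x ^ (α - 1)| = 2 * |B| * x ^ (α - 1) := by
      rw [abs_mul, abs_mul, abs_two, abs_of_pos (by positivity : 0 < x ^ (α - 1))]
    have h3 := abs_sub_le ((w (2 * i + e))⁻¹ - x ^ α) (2 * B * x ^ (α - 1)) 0
    rw [sub_zero, sub_zero, h2] at h3
    calc _ ≤ C₀ * x ^ (α - 2) + 2 * |B| * x ^ (α - 1) := h3.trans (by gcongr)
      _ ≤ C₀ * x ^ (α - 1) + 2 * |B| * x ^ (α - 1) := by gcongr
      _ = (2 * |B| + C₀) * x ^ (α - 1) := by ring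
      _ ≤ _ := by gcongr
  rw [← hyα]
  calc |(w (2 * i + e))⁻¹ - y ^ α| ≤ |(w (2 * i + e))⁻¹ - x ^ α| + |x ^ α - y ^ α| :=
        abs_sub_le _ _ _
    _ ≤ (2 * |B| + C₀) * (2 * y ^ (α - 1)) + 2 * |A| * y ^ (α - 1) := add_le_add h1 hxy1
    _ = _ := by rw [hyα1]; ring

lemma InvPowerGrowth.two_sided {v : ℕ → ℝ} {α c C : ℝ} (h : InvPowerGrowth v α c C)
    (hv : ∀ i, 0 < v i) (hc : 0 < c) (hC : 0 < C) :
    ∃ K > 0, ∀ k : ℕ, (v k)⁻¹ ≤ K * ((k : ℝ) + 1) ^ α ∧ ((k : ℝ) + 1) ^ α ≤ K * (v k)⁻¹ := by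
  have hp : ∀ k : ℕ, ((k : ℝ) + 1) ^ (α - 1) = ((k : ℝ) + 1) ^ α / ((k : ℝ) + 1) := fun k =>
    Real.rpow_sub_one (by positivity) α
  have hlow : ∀ᶠ k : ℕ in atTop, ((k : ℝ) + 1) ^ α ≤ (2 / c) * (v k)⁻¹ := by
    filter_upwards [eventually_ge_atTop ⌈2 * C / c⌉₊] with k hk
    have h1 : 2 * C / c ≤ (k : ℝ) + 1 := (Nat.ceil_le.1 hk).trans (by linarith)
    have h2 := (abs_le.1 (h k)).1
    rw [hp] at h2
    have h3 : 0 < ((k : ℝ) + 1) ^ α := by positivity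
    have h4 : C * (((k : ℝ) + 1) ^ α / ((k : ℝ) + 1)) ≤ c / 2 * ((k : ℝ) + 1) ^ α := by
      rw [← mul_div_assoc, div_le_iff₀ (by positivity)]
      rw [div_le_iff₀ hc] at h1
      nlinarith
    rw [div_mul_eq_mul_div, le_div_iff₀ hc]
    linarith
  obtain ⟨K, hK, hK'⟩ := exists_forall_le_mul_of_eventually (fun i => inv_pos.2 (hv i)) hlow
  refine ⟨max K (c + C), by positivity, fun k => ⟨?_, ?_⟩⟩
  · have h2 := (abs_le.1 (h k)).2
    rw [hp] at h2
    have h3 : 0 < ((k : ℝ) + 1) ^ α := by positivity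
    have h4 : ((k : ℝ) + 1) ^ α / ((k : ℝ) + 1) ≤ ((k : ℝ) + 1) ^ α :=
      div_le_self h3.le (by linarith [(Nat.cast_nonneg k : (0 : ℝ) ≤ k)])
    have h5 : (c + C) * ((k : ℝ) + 1) ^ α ≤ max K (c + C) * ((k : ℝ) + 1) ^ α :=
      mul_le_mul_of_nonneg_right (le_max_right _ _) h3.le
    nlinarith
  · exact (hK' k).trans (mul_le_mul_of_nonneg_right (le_max_left _ _) (inv_pos.2 (hv k)).le)

lemma InvPowerGrowth.local_const {v : ℕ → ℝ} {α c C : ℝ} (h : InvPowerGrowth v α c C)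
    (hc : 0 < c) (hC : 0 < C) {ε : ℝ} (hε : 0 < ε) :
    ∃ δ > 0, ∃ A : ℝ, ∀ n k : ℕ, A ≤ n → 1 ≤ n → |(k : ℝ) - n| ≤ δ * n →
      |(v k)⁻¹ - c * (n : ℝ) ^ α| ≤ ε * (n : ℝ) ^ α := by
  have hcont : ContinuousAt (fun t : ℝ => t ^ α) 1 :=
    Real.continuousAt_rpow_const _ _ (Or.inl one_ne_zero)
  obtain ⟨η, hη, hcl⟩ := Metric.continuousAt_iff.1 hcont (min 1 (ε / (2 * c))) (by positivity)
  refine ⟨min (1 / 2) (η / 3), by positivity, max (3 / η) (8 * C / ε), fun n k hn hn1 hk => ?_⟩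
  have hn1' : (1 : ℝ) ≤ n := by exact_mod_cast hn1
  have hn0 : (0 : ℝ) < n := by linarith
  have hA1 : 3 / η ≤ n := (le_max_left _ _).trans hn
  have hA2 : 8 * C / ε ≤ n := (le_max_right _ _).trans hn
  rw [div_le_iff₀ hη] at hA1
  rw [div_le_iff₀ hε] at hA2
  have hk1 : |(k : ℝ) - n| ≤ 1 / 2 * n :=
    hk.trans (mul_le_mul_of_nonneg_right (min_le_left _ _) hn0.le)
  have hk2 : |(k : ℝ) - n| ≤ η / 3 * n :=
    hk.trans (mul_le_mul_of_nonneg_right (min_le_right _ _) hn0.le)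
  set t : ℝ := ((k : ℝ) + 1) / n with ht
  have hkt : (k : ℝ) + 1 = t * n := by rw [ht]; field_simp
  have hk0 : (0 : ℝ) < (k : ℝ) + 1 := by positivity
  have ht0 : 0 < t := by positivity
  have htη : |t - 1| < η := by
    have : t - 1 = ((k : ℝ) - n + 1) / n := by rw [ht]; field_simp; ring
    rw [this, abs_div, abs_of_pos hn0, div_lt_iff₀ hn0]
    have := abs_add_le ((k : ℝ) - n) 1
    rw [abs_one] at this
    nlinarith
  have hcl' := hcl (x := t) (by rwa [Real.dist_eq])
  rw [Real.dist_eq, Real.one_rpow, lt_min_iff] at hcl'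
  obtain ⟨hc1, hc2⟩ := hcl'
  have hL : 0 < (n : ℝ) ^ α := by positivity
  have hkα : ((k : ℝ) + 1) ^ α = t ^ α * (n : ℝ) ^ α := by
    rw [hkt, Real.mul_rpow ht0.le hn0.le]
  have h1 : C * ((k : ℝ) + 1) ^ (α - 1) ≤ ε / 2 * (n : ℝ) ^ α := by
    rw [Real.rpow_sub_one hk0.ne', hkα, ← mul_div_assoc, div_le_iff₀ hk0]
    have h2 : t ^ α ≤ 2 := by linarith [(abs_lt.1 hc1).2]
    have h3 : (n : ℝ) / 2 ≤ (k : ℝ) + 1 := by linarith [(abs_le.1 hk1).1]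
    calc C * (t ^ α * (n : ℝ) ^ α) ≤ C * (2 * (n : ℝ) ^ α) := by gcongr
      _ ≤ ε / 2 * (n : ℝ) ^ α * (n / 2) := by nlinarith
      _ ≤ _ := by gcongr
  have h2 : |c * ((k : ℝ) + 1) ^ α - c * (n : ℝ) ^ α| ≤ ε / 2 * (n : ℝ) ^ α := by
    have : c * ((k : ℝ) + 1) ^ α - c * (n : ℝ) ^ α = c * (n : ℝ) ^ α * (t ^ α - 1) := by
      rw [hkα]; ring
    rw [this, abs_mul, abs_of_pos (by positivity)]
    rw [lt_div_iff₀ (by positivity)] at hc2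
    nlinarith
  have h3 := abs_sub_le ((v k)⁻¹) (c * ((k : ℝ) + 1) ^ α) (c * (n : ℝ) ^ α)
  linarith [h k]

lemma invSum_sub_eq_sum_Ico (v : ℕ → ℝ) {m n : ℕ} (h : m ≤ n) :
    invSum v n - invSum v m = ∑ k ∈ Finset.Ico m n, (v k)⁻¹ :=
  (Finset.sum_Ico_eq_sub _ h).symm

lemma invSum_le {v : ℕ → ℝ} {α K : ℝ} (hα : 0 < α) (hK : 0 < K)
    (h : ∀ k : ℕ, (v k)⁻¹ ≤ K * ((k : ℝ) + 1) ^ α) (m : ℕ) :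
    invSum v m ≤ K * (m * (m : ℝ) ^ α) := by
  calc invSum v m ≤ ∑ k ∈ Finset.range m, K * (m : ℝ) ^ α := by
        refine Finset.sum_le_sum fun k hk => (h k).trans ?_
        have : (k : ℝ) + 1 ≤ m := by exact_mod_cast Finset.mem_range.1 hk
        gcongr
    _ = _ := by rw [Finset.sum_const, Finset.card_range, nsmul_eq_mul]; ring

lemma invSqSum_le {v : ℕ → ℝ} {α K : ℝ} (hv : ∀ i, 0 < v i) (hα : 0 < α) (hK : 0 < K)
    (h : ∀ k : ℕ, (v k)⁻¹ ≤ K * ((k : ℝ) + 1) ^ α) (m : ℕ) :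
    invSqSum v m ≤ K * (m : ℝ) ^ α * invSum v m := by
  rw [invSqSum, invSum, Finset.mul_sum]
  refine Finset.sum_le_sum fun k hk => ?_
  have h1 : (k : ℝ) + 1 ≤ m := by exact_mod_cast Finset.mem_range.1 hk
  have h2 := inv_pos.2 (hv k)
  rw [sq]
  refine mul_le_mul_of_nonneg_right ((h k).trans ?_) h2.le
  gcongr

lemma mul_abs_sub_le_invSum {v : ℕ → ℝ} {α K : ℝ} (hv : ∀ i, 0 < v i) (hα : 0 < α) (hK : 0 < K)
    (h : ∀ k : ℕ, ((k : ℝ) + 1) ^ α ≤ K * (v k)⁻¹) (m n : ℕ) :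
    (n : ℝ) ^ α * |(m : ℝ) - n| ≤ 2 * 2 ^ α * K * |invSum v m - invSum v n| := by
  have h2α : (1 : ℝ) ≤ 2 ^ α := Real.one_le_rpow (by norm_num) hα.le
  rcases le_total n m with hnm | hmn
  · have hnm' : (n : ℝ) ≤ m := by exact_mod_cast hnm
    have h0 := invSum_mono hv hnm
    rw [abs_of_nonneg (by linarith), abs_of_nonneg (by linarith)]
    have h1 : ((m : ℝ) - n) * (n : ℝ) ^ α ≤ K * (invSum v m - invSum v n) := by
      rw [invSum_sub_eq_sum_Ico v hnm, Finset.mul_sum]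
      calc ((m : ℝ) - n) * (n : ℝ) ^ α = ∑ k ∈ Finset.Ico n m, (n : ℝ) ^ α := by
            rw [Finset.sum_const, Nat.card_Ico, nsmul_eq_mul, Nat.cast_sub hnm]
        _ ≤ _ := by
            refine Finset.sum_le_sum fun k hk => le_trans ?_ (h k)
            have : (n : ℝ) ≤ k := by exact_mod_cast (Finset.mem_Ico.1 hk).1
            exact Real.rpow_le_rpow (by positivity) (by linarith) hα.le
    have h3 : 0 ≤ K * (invSum v m - invSum v n) := mul_nonneg hK.le (by linarith)
    nlinarith
  · have hmn' : (m : ℝ) ≤ n := by exact_mod_cast hmn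
    have h0 := invSum_mono hv hmn
    rw [abs_sub_comm, abs_sub_comm (invSum v m), abs_of_nonneg (by linarith),
      abs_of_nonneg (by linarith)]
    set p := (m + n) / 2 with hp
    have hpn : p ≤ n := by omega
    have h1 : ((n : ℝ) - p) * ((n : ℝ) / 2) ^ α ≤ K * (invSum v n - invSum v p) := by
      rw [invSum_sub_eq_sum_Ico v hpn, Finset.mul_sum]
      calc ((n : ℝ) - p) * ((n : ℝ) / 2) ^ α = ∑ k ∈ Finset.Ico p n, ((n : ℝ) / 2) ^ α := by
            rw [Finset.sum_const, Nat.card_Ico, nsmul_eq_mul, Nat.cast_sub hpn]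
        _ ≤ _ := by
            refine Finset.sum_le_sum fun k hk => le_trans ?_ (h k)
            have h4 := (Finset.mem_Ico.1 hk).1
            have : (n : ℝ) ≤ 2 * (k + 1) := by exact_mod_cast (by omega : n ≤ 2 * (k + 1))
            exact Real.rpow_le_rpow (by positivity) (by linarith) hα.le
    have h5 : (n : ℝ) - m ≤ 2 * ((n : ℝ) - p) := by
      have : (2 * p : ℝ) ≤ m + n := by exact_mod_cast (by omega : 2 * p ≤ m + n)
      linarith
    have h6 : invSum v m ≤ invSum v p := invSum_mono hv (by omega)
    rw [Real.div_rpow (by positivity) (by norm_num), ← mul_div_assoc,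
      div_le_iff₀ (by positivity)] at h1
    have h7 : (0 : ℝ) ≤ (n : ℝ) ^ α := by positivity
    calc (n : ℝ) ^ α * ((n : ℝ) - m) ≤ (n : ℝ) ^ α * (2 * ((n : ℝ) - p)) := by gcongr
      _ = 2 * (((n : ℝ) - p) * (n : ℝ) ^ α) := by ring
      _ ≤ 2 * (K * (invSum v n - invSum v p) * 2 ^ α) := by gcongr
      _ = 2 * 2 ^ α * K * (invSum v n - invSum v p) := by ring
      _ ≤ _ := by gcongr

/-- A lower bound for the square of the martingale, strong enough to absorb its bracket. -/
lemma exists_sq_ge_invSqSum {b r : ℕ → ℝ} {α K : ℝ} (hb : ∀ i, 0 < b i) (hr : ∀ i, 0 < r i)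
    (hα : 0 < α) (hK : 0 < K) (hbu : ∀ k : ℕ, (b k)⁻¹ ≤ K * ((k : ℝ) + 1) ^ α)
    (hru : ∀ k : ℕ, (r k)⁻¹ ≤ K * ((k : ℝ) + 1) ^ α)
    (hrl : ∀ k : ℕ, ((k : ℝ) + 1) ^ α ≤ K * (r k)⁻¹) :
    ∃ C > 0, ∀ n : ℕ, 1 ≤ n → ∀ m, ∀ i ≤ n,
      2 * invSqSum r m - C * (n * ((n : ℝ) ^ α) ^ 2) ≤ (invSum r m - invSum b i) ^ 2 := by
  obtain ⟨K₁, hK₁, hrl'⟩ : ∃ K₁ > 0, ∀ m : ℕ, (m : ℝ) * (m : ℝ) ^ α ≤ K₁ * invSum r m := by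
    refine ⟨2 * 2 ^ α * K, by positivity, fun m => ?_⟩
    have := mul_abs_sub_le_invSum hr hα hK hrl 0 m
    have h0 := invSum_nonneg hr m
    simp only [invSum, Finset.range_zero, Finset.sum_empty, Nat.cast_zero, zero_sub, abs_neg,
      Nat.abs_cast] at this h0 ⊢
    rw [abs_of_nonneg h0] at this
    linarith
  set Λ : ℝ := 2 * K * K₁ + 8 * K * K₁ + 1 with hΛ
  have hKK : 0 < K * K₁ := by positivity
  refine ⟨2 * (K * K * (Λ * (Λ ^ α) ^ 2)), by positivity, fun n hn m i hi => ?_⟩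
  have hn1 : (1 : ℝ) ≤ n := by exact_mod_cast hn
  have hφ0 := invSum_nonneg hr m
  have hψ := invSqSum_le hr hα hK hru m
  have hmα : (0 : ℝ) ≤ (m : ℝ) ^ α := by positivity
  by_cases hm : (m : ℝ) ≤ Λ * n
  · have h1 : (m : ℝ) ^ α ≤ Λ ^ α * (n : ℝ) ^ α := by
      rw [← Real.mul_rpow (by positivity) (by positivity)]
      exact Real.rpow_le_rpow (by positivity) hm hα.le
    have h2 := invSum_le hα hK hru m
    have h3 : invSqSum r m ≤ K * K * (Λ * (Λ ^ α) ^ 2) * (n * ((n : ℝ) ^ α) ^ 2) :=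
      calc invSqSum r m ≤ K * (m : ℝ) ^ α * (K * (m * (m : ℝ) ^ α)) := hψ.trans (by gcongr)
        _ ≤ K * (Λ ^ α * (n : ℝ) ^ α) * (K * ((Λ * n) * (Λ ^ α * (n : ℝ) ^ α))) := by gcongr
        _ = _ := by ring
    have := sq_nonneg (invSum r m - invSum b i)
    linarith
  · push Not at hm
    have hm0 : (0 : ℝ) < m := lt_of_le_of_lt (by positivity) hm
    have hnm : (n : ℝ) ≤ m := by nlinarith
    have hΛm : Λ ≤ m := by nlinarith
    have h1 : invSum b i ≤ invSum r m / 2 := by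
      have h2 : invSum b i ≤ K * (n * (n : ℝ) ^ α) :=
        (invSum_mono hb hi).trans (invSum_le hα hK hbu n)
      have h3 : K * (n * (n : ℝ) ^ α) ≤ K * (n * (m : ℝ) ^ α) := by gcongr
      have h4 : 2 * K * K₁ * (n * (m : ℝ) ^ α) ≤ m * (m : ℝ) ^ α := by
        have : 2 * K * K₁ * n ≤ m := by nlinarith
        nlinarith
      have h5 := hrl' m
      have h6 : K₁ * (2 * (K * (n * (m : ℝ) ^ α))) ≤ K₁ * invSum r m := by linarith
      have h7 := le_of_mul_le_mul_left h6 hK₁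
      linarith
    have h2 : invSum r m ^ 2 / 4 ≤ (invSum r m - invSum b i) ^ 2 := by nlinarith
    have h3 : 8 * (K * (m : ℝ) ^ α) ≤ invSum r m := by
      have h4 : 8 * K * K₁ * (m : ℝ) ^ α ≤ m * (m : ℝ) ^ α := by
        have : 8 * K * K₁ ≤ m := by nlinarith
        gcongr
      have h6 : K₁ * (8 * (K * (m : ℝ) ^ α)) ≤ K₁ * invSum r m := by linarith [hrl' m]
      exact le_of_mul_le_mul_left h6 hK₁
    have h4 : 0 ≤ 2 * (K * K * (Λ * (Λ ^ α) ^ 2)) * (n * ((n : ℝ) ^ α) ^ 2) := by positivity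
    nlinarith

lemma sum_rpow_sub_one_le {α : ℝ} (hα : 0 < α) (n : ℕ) :
    min α 1 * ∑ k ∈ Finset.range n, ((k : ℝ) + 1) ^ (α - 1) ≤ (n : ℝ) ^ α := by
  induction n with
  | zero => simp [Real.zero_rpow hα.ne']
  | succ n ih =>
    rw [Finset.sum_range_succ, mul_add]
    set x : ℝ := 1 / ((n : ℝ) + 1) with hx
    have hn : (0 : ℝ) < (n : ℝ) + 1 := by positivity
    have hx0 : 0 ≤ x := by positivity
    have hx1 : x ≤ 1 := by rw [hx, div_le_one hn]; linarith [(Nat.cast_nonneg n : (0 : ℝ) ≤ n)]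
    have h1 : (1 - x) ^ α ≤ 1 - min α 1 * x := by
      rcases le_total α 1 with h | h
      · rw [min_eq_left h]
        have := rpow_one_add_le_one_add_mul_self (s := -x) (by linarith) hα.le h
        rw [← sub_eq_add_neg] at this
        linarith
      · rw [min_eq_right h, one_mul]
        exact (Real.rpow_le_rpow_of_exponent_ge' (by linarith) (by linarith) zero_le_one h).trans
          (by rw [Real.rpow_one])
    have h2 : (n : ℝ) ^ α = ((n : ℝ) + 1) ^ α * (1 - x) ^ α := by
      rw [← Real.mul_rpow hn.le (by linarith)]
      congr 1
      rw [hx]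
      field_simp
      ring
    have h3 : ((n : ℝ) + 1) ^ (α - 1) = ((n : ℝ) + 1) ^ α * x := by
      rw [Real.rpow_sub_one hn.ne', hx]; ring
    have h4 : (0 : ℝ) ≤ ((n : ℝ) + 1) ^ α := by positivity
    rw [h3]
    push_cast
    nlinarith [mul_le_mul_of_nonneg_left h1 h4]

lemma abs_invSum_sub_invSum_le {b r : ℕ → ℝ} {α c C : ℝ} (hα : 0 < α) (hC : 0 < C)
    (hb : InvPowerGrowth b α c C) (hr : InvPowerGrowth r α c C) (n : ℕ) :
    |invSum r n - invSum b n| ≤ 2 * C / min α 1 * (n : ℝ) ^ α := by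
  have hmin : 0 < min α 1 := lt_min hα one_pos
  rw [invSum, invSum, ← Finset.sum_sub_distrib]
  calc |∑ k ∈ Finset.range n, ((r k)⁻¹ - (b k)⁻¹)|
      ≤ ∑ k ∈ Finset.range n, |(r k)⁻¹ - (b k)⁻¹| := Finset.abs_sum_le_sum_abs _ _
    _ ≤ ∑ k ∈ Finset.range n, 2 * C * ((k : ℝ) + 1) ^ (α - 1) := by
        refine Finset.sum_le_sum fun k _ => ?_
        have h1 := abs_sub_le ((r k)⁻¹) (c * ((k : ℝ) + 1) ^ α) ((b k)⁻¹)
        have h2 := hb k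
        rw [abs_sub_comm] at h2
        linarith [hr k]
    _ = 2 * C / min α 1 * (min α 1 * ∑ k ∈ Finset.range n, ((k : ℝ) + 1) ^ (α - 1)) := by
        rw [← Finset.mul_sum]; field_simp
    _ ≤ _ := by gcongr; exact sum_rpow_sub_one_le hα n

lemma abs_sub_invSum_le_of_near {v : ℕ → ℝ} {a ε : ℝ} {m n : ℕ} {δ : ℝ}
    (h : ∀ k : ℕ, |(k : ℝ) - n| ≤ δ → |(v k)⁻¹ - a| ≤ ε) (hmn : |(m : ℝ) - n| ≤ δ) :
    |a * ((m : ℝ) - n) - (invSum v m - invSum v n)| ≤ ε * |(m : ℝ) - n| := by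
  have key : ∀ p q : ℕ, p ≤ q → (∀ k ∈ Finset.Ico p q, |(v k)⁻¹ - a| ≤ ε) →
      |a * ((q : ℝ) - p) - (invSum v q - invSum v p)| ≤ ε * ((q : ℝ) - p) := fun p q hpq hk => by
    rw [invSum_sub_eq_sum_Ico v hpq, abs_sub_comm]
    calc |∑ k ∈ Finset.Ico p q, (v k)⁻¹ - a * ((q : ℝ) - p)|
        = |∑ k ∈ Finset.Ico p q, ((v k)⁻¹ - a)| := by
          rw [Finset.sum_sub_distrib, Finset.sum_const, Nat.card_Ico, nsmul_eq_mul,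
            Nat.cast_sub hpq, mul_comm a]
      _ ≤ ∑ k ∈ Finset.Ico p q, |(v k)⁻¹ - a| := Finset.abs_sum_le_sum_abs _ _
      _ ≤ ∑ k ∈ Finset.Ico p q, ε := Finset.sum_le_sum hk
      _ = _ := by rw [Finset.sum_const, Nat.card_Ico, nsmul_eq_mul, Nat.cast_sub hpq, mul_comm]
  rcases le_total n m with hnm | hnm
  · have hc : (n : ℝ) ≤ m := by exact_mod_cast hnm
    rw [abs_of_nonneg (by linarith : (0 : ℝ) ≤ (m : ℝ) - n)] at hmn ⊢
    refine key n m hnm fun k hk => h k ?_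
    have h1 : (n : ℝ) ≤ k := by exact_mod_cast (Finset.mem_Ico.1 hk).1
    have h2 : (k : ℝ) ≤ m := by exact_mod_cast (Finset.mem_Ico.1 hk).2.le
    rw [abs_of_nonneg (by linarith)]
    linarith
  · have hc : (m : ℝ) ≤ n := by exact_mod_cast hnm
    rw [abs_of_nonpos (by linarith : (m : ℝ) - n ≤ 0)] at hmn ⊢
    have := key m n hnm fun k hk => h k (by
      have h1 : (m : ℝ) ≤ k := by exact_mod_cast (Finset.mem_Ico.1 hk).1
      have h2 : (k : ℝ) ≤ n := by exact_mod_cast (Finset.mem_Ico.1 hk).2.le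
      rw [abs_of_nonpos (by linarith)]
      linarith)
    rw [← abs_neg]
    convert this using 2 <;> ring

lemma linearization_at_tau {b r : ℕ → ℝ} {α c C : ℝ} (hα : 0 < α) (hc : 0 < c) (hC : 0 < C)
    (hrpos : ∀ i, 0 < r i) (hb : InvPowerGrowth b α c C) (hr : InvPowerGrowth r α c C)
    {ε : ℝ} (hε : 0 < ε) :
    ∀ᶠ n : ℕ in atTop, ∀ m : ℕ,
      |c * (n : ℝ) ^ α * ((m : ℝ) - n) - (invSum r m - invSum b n)| ≤
        ε * ((n : ℝ) ^ α * √n) +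
          ε * ((invSum r m - invSum b n) ^ 2 / ((n : ℝ) ^ α * √n)) := by
  obtain ⟨K₀, hK₀, hK₀'⟩ := hr.two_sided hrpos hc hC
  set K : ℝ := 2 * 2 ^ α * K₀ with hK
  have hKpos : 0 < K := by positivity
  have hslope := mul_abs_sub_le_invSum hrpos hα hK₀ fun k => (hK₀' k).2
  set E : ℝ := 2 * C / min α 1 with hE
  have hmin : 0 < min α 1 := lt_min hα one_pos
  have hEpos : 0 < E := by positivity
  have hgap := abs_invSum_sub_invSum_le hα hC hb hr
  obtain ⟨δ, hδ, A, hA⟩ := hr.local_const hc hC (ε := ε / (2 * K)) (by positivity)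
  set G : ℝ := c * K + 1 with hG
  have hGpos : 0 < G := by positivity
  have hsqrt : Tendsto (fun n : ℕ => √(n : ℝ)) atTop atTop :=
    Real.tendsto_sqrt_atTop.comp tendsto_natCast_atTop_atTop
  filter_upwards [eventually_ge_atTop 1, tendsto_natCast_atTop_atTop.eventually_ge_atTop A,
    hsqrt.eventually_ge_atTop 1, hsqrt.eventually_ge_atTop ((ε / 2 + 1) * E / (ε / 2)),
    hsqrt.eventually_ge_atTop ((G + 1) * E / ε),
    hsqrt.eventually_ge_atTop (K * (E + G / ε) / δ)] with n hn1 hnA hy1 hy2 hy3 hy4 m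
  rw [div_le_iff₀ (by positivity)] at hy2 hy3 hy4
  have hnpos : (0 : ℝ) < n := by exact_mod_cast hn1
  set y : ℝ := √(n : ℝ) with hy
  have hyn : y * y = n := Real.mul_self_sqrt hnpos.le
  have hy0 : 0 < y := by linarith
  set L : ℝ := (n : ℝ) ^ α with hL
  have hLpos : 0 < L := by positivity
  set M : ℝ := invSum r m - invSum b n with hM
  set M' : ℝ := invSum r m - invSum r n with hM'
  have hs : 0 < L * y := by positivity
  have hMM : |M - M'| ≤ E * L := by
    have : M - M' = invSum r n - invSum b n := by rw [hM, hM']; ring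
    rw [this]; exact hgap n
  have hM'M : |M'| ≤ |M| + E * L := by
    have := abs_sub_le M' M 0
    rw [sub_zero, sub_zero, abs_sub_comm M' M] at this
    linarith
  have hMM' : |M| ≤ |M'| + E * L := by
    have := abs_sub_le M M' 0
    rw [sub_zero, sub_zero] at this
    linarith
  have htri := abs_sub_le (c * L * ((m : ℝ) - n)) M' M
  rw [abs_sub_comm M' M] at htri
  have hsl : L * |(m : ℝ) - n| ≤ K * |M'| := hslope m n
  have hQ : 0 ≤ M ^ 2 / (L * y) := by positivity
  clear_value y L M M' E K G
  by_cases hnear : |(m : ℝ) - n| ≤ δ * n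
  · have h1 : |c * L * ((m : ℝ) - n) - M'| ≤ ε / (2 * K) * L * |(m : ℝ) - n| := by
      rw [hL, hM']
      exact abs_sub_invSum_le_of_near (fun k hk => hA n k hnA hn1 hk) hnear
    have h2 : ε / (2 * K) * L * |(m : ℝ) - n| ≤ ε / 2 * |M'| := by
      calc ε / (2 * K) * L * |(m : ℝ) - n| = ε / (2 * K) * (L * |(m : ℝ) - n|) := by ring
        _ ≤ ε / (2 * K) * (K * |M'|) := by gcongr
        _ = _ := by field_simp
    have h3 : |M| ≤ L * y + M ^ 2 / (L * y) := by
      rw [← sub_le_iff_le_add', le_div_iff₀ hs, ← sq_abs M]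
      nlinarith [sq_nonneg (|M| - L * y), mul_nonneg (abs_nonneg M) hs.le]
    have h4 : (ε / 2 + 1) * E * L ≤ ε / 2 * (L * y) := by
      calc (ε / 2 + 1) * E * L ≤ y * (ε / 2) * L := by gcongr
        _ = _ := by ring
    have h5 : ε / 2 * |M'| ≤ ε / 2 * (|M| + E * L) := by gcongr
    have h6 : ε / 2 * |M| ≤ ε / 2 * (L * y + M ^ 2 / (L * y)) := by gcongr
    have h7 : 0 ≤ ε * (M ^ 2 / (L * y)) := by positivity
    linarith
  · push Not at hnear
    have h1 : |c * L * ((m : ℝ) - n) - M'| ≤ G * |M'| := by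
      have h2 := abs_sub (c * L * ((m : ℝ) - n)) M'
      rw [abs_mul, abs_of_pos (by positivity : 0 < c * L)] at h2
      have h3 : c * (L * |(m : ℝ) - n|) ≤ c * (K * |M'|) := by gcongr
      rw [hG]
      linarith
    have h2 : G / ε * (L * y) ≤ |M| := by
      have h3 : L * (δ * n) ≤ K * |M'| := (by gcongr : L * (δ * n) ≤ L * |(m : ℝ) - n|).trans hsl
      have h4 : K * (E + G / ε) * y ≤ δ * n := by
        calc K * (E + G / ε) * y ≤ y * δ * y := by gcongr
          _ = _ := by rw [← hyn]; ring
      have h5 : K * ((E + G / ε) * y * L) ≤ K * |M'| := by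
        calc K * ((E + G / ε) * y * L) = L * (K * (E + G / ε) * y) := by ring
          _ ≤ L * (δ * n) := by gcongr
          _ ≤ _ := h3
      have h6 := le_of_mul_le_mul_left h5 hKpos
      have h7 : E * L ≤ E * L * y := le_mul_of_one_le_right (by positivity) hy1
      linarith
    have h3 : G * |M| ≤ ε * (M ^ 2 / (L * y)) := by
      rw [← mul_div_assoc, le_div_iff₀ hs, ← sq_abs M]
      rw [div_mul_eq_mul_div, div_le_iff₀ hε] at h2
      calc G * |M| * (L * y) = G * (L * y) * |M| := by ring
        _ ≤ |M| * ε * |M| := by gcongr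
        _ = _ := by ring
    have h4 : (G + 1) * E * L ≤ ε * (L * y) := by
      calc (G + 1) * E * L ≤ y * ε * L := by gcongr
        _ = _ := by ring
    have h5 : G * |M'| ≤ G * (|M| + E * L) := by gcongr
    linarith

theorem UrnChoice.exists_invPowerGrowth {w b r : ℕ → ℝ} {α B : ℝ} (h : WeightAsymp w α B)
    (hα : 0 < α) (hchoice : UrnChoice w b r) :
    ∃ C > 0, InvPowerGrowth b α (2 ^ α) C ∧ InvPowerGrowth r α (2 ^ α) C := by
  obtain ⟨C₀, hC₀, h0⟩ := h.invPowerGrowth hα 0 (by norm_num)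
  obtain ⟨C₁, hC₁, h1⟩ := h.invPowerGrowth hα 1 le_rfl
  have h0' := h0.mono (le_max_left C₀ C₁)
  have h1' := h1.mono (le_max_right C₀ C₁)
  refine ⟨max C₀ C₁, by positivity, ?_⟩
  have e0 : ∀ v : ℕ → ℝ, (∀ i, v i = w (2 * i)) → InvPowerGrowth v α (2 ^ α) (max C₀ C₁) :=
    fun v hv k => by rw [hv]; exact h0' k
  have e1 : ∀ v : ℕ → ℝ, (∀ i, v i = w (2 * i + 1)) → InvPowerGrowth v α (2 ^ α) (max C₀ C₁) :=
    fun v hv k => by rw [hv]; exact h1' k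
  rcases hchoice with h | h | h
  · exact ⟨e0 b fun i => (h i).1, e1 r fun i => (h i).2⟩
  · exact ⟨e1 b fun i => (h i).1, e0 r fun i => (h i).2⟩
  · exact ⟨e0 b fun i => (h i).1, e0 r fun i => (h i).2⟩

lemma tendsto_invSqSum_atTop {v : ℕ → ℝ} {α K : ℝ} (hα : 0 < α) (hK : 0 < K)
    (h : ∀ k : ℕ, ((k : ℝ) + 1) ^ α ≤ K * (v k)⁻¹) : Tendsto (invSqSum v) atTop atTop := by
  have h1 : ∀ m : ℕ, (m : ℝ) * (1 / K) ^ 2 ≤ invSqSum v m := fun m => by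
    calc (m : ℝ) * (1 / K) ^ 2 = ∑ k ∈ Finset.range m, (1 / K) ^ 2 := by
          rw [Finset.sum_const, Finset.card_range, nsmul_eq_mul]
      _ ≤ _ := by
          refine Finset.sum_le_sum fun k _ => ?_
          have h2 : (1 : ℝ) ≤ ((k : ℝ) + 1) ^ α :=
            Real.one_le_rpow (by linarith [(Nat.cast_nonneg k : (0 : ℝ) ≤ k)]) hα.le
          have h3 : 1 / K ≤ (v k)⁻¹ := by
            rw [div_le_iff₀ hK, mul_comm]
            exact h2.trans (h k)
          gcongr
  exact tendsto_atTop_mono h1 (tendsto_natCast_atTop_atTop.atTop_mul_const (by positivity))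

theorem mean_discrepancy_at_tau_sublinear {Ω : Type*} [MeasurableSpace Ω] (μ : MeasureTheory.Measure Ω) [MeasureTheory.IsProbabilityMeasure μ]
    (α B : ℝ) (hα : 0 < α) (w : ℕ → ℝ) (hw : ∀ n, 0 < w n)
    (hasymp : WeightAsymp w α B)
    (b r : ℕ → ℝ) (hb : ∀ i, 0 < b i) (hr : ∀ i, 0 < r i)
    (hchoice : UrnChoice w b r) (U : Urn μ b r) :
    Tendsto (fun n : ℕ => (∫ ω, (U.D (U.tau n ω) ω : ℝ) ∂μ) / Real.sqrt n)
      atTop (nhds 0) := by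
  obtain ⟨C, hC, hbg, hrg⟩ := hchoice.exists_invPowerGrowth hasymp hα
  have hc : (0 : ℝ) < 2 ^ α := by positivity
  obtain ⟨Kb, hKb, hKb'⟩ := hbg.two_sided hb hc hC
  obtain ⟨Kr, hKr, hKr'⟩ := hrg.two_sided hr hc hC
  set K := max Kb Kr with hK
  have hKpos : 0 < K := by positivity
  have hbu : ∀ k : ℕ, (b k)⁻¹ ≤ K * ((k : ℝ) + 1) ^ α := fun k =>
    (hKb' k).1.trans (mul_le_mul_of_nonneg_right (le_max_left _ _) (by positivity))
  have hru : ∀ k : ℕ, (r k)⁻¹ ≤ K * ((k : ℝ) + 1) ^ α := fun k =>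
    (hKr' k).1.trans (mul_le_mul_of_nonneg_right (le_max_right _ _) (by positivity))
  have hrl : ∀ k : ℕ, ((k : ℝ) + 1) ^ α ≤ K * (r k)⁻¹ := fun k =>
    (hKr' k).2.trans (mul_le_mul_of_nonneg_right (le_max_right _ _) (inv_pos.2 (hr k)).le)
  have htop := tendsto_invSqSum_atTop hα hKpos hrl
  obtain ⟨H, hH, hsq⟩ := exists_sq_ge_invSqSum hb hr hα hKpos hbu hru hrl
  set T : ℝ := H + 2 * (K * K) with hT
  rw [Metric.tendsto_nhds]
  intro η hη
  set ε : ℝ := η * 2 ^ α / (2 * (1 + T)) with hε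
  have hTpos : 0 < T := by positivity
  have hεpos : 0 < ε := by positivity
  filter_upwards [eventually_ge_atTop 1,
    linearization_at_tau hα hc hC hr hbg hrg hεpos] with n hn hlin
  have hn0 : (0 : ℝ) < n := by exact_mod_cast hn
  obtain ⟨hmeas, hMint, hM0, hM2int, hM2⟩ := U.moments_at_tau n hb hr (hsq n hn) htop
  have hae := U.ae_exists_le_Bl n hb hr (hsq n hn) htop
  set L : ℝ := (n : ℝ) ^ α with hL
  have hLpos : 0 < L := by positivity
  set y : ℝ := √(n : ℝ) with hy
  have hy0 : 0 < y := Real.sqrt_pos.2 hn0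
  have hyn : y * y = n := Real.mul_self_sqrt hn0.le
  set M : Ω → ℝ := fun ω => invSum r (U.Re (U.tau n ω) ω) - invSum b n with hM
  have hM2' : ∫ ω, M ω ^ 2 ∂μ ≤ T * (L * y) * (L * y) := by
    have h1 : invSqSum b n ≤ K * L * (K * (n * L)) :=
      (invSqSum_le hb hα hKpos hbu n).trans
        (mul_le_mul_of_nonneg_left (invSum_le hα hKpos hbu n) (by positivity))
    calc ∫ ω, M ω ^ 2 ∂μ ≤ H * (n * L ^ 2) + 2 * invSqSum b n := hM2
      _ ≤ H * (n * L ^ 2) + 2 * (K * L * (K * (n * L))) := by gcongr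
      _ = T * (L * y) * (L * y) := by rw [← hyn]; ring
  set X : Ω → ℝ := fun ω => (U.Re (U.tau n ω) ω : ℝ) - n with hX
  have hDX : (fun ω => (U.D (U.tau n ω) ω : ℝ)) =ᵐ[μ] X := by
    filter_upwards [hae] with ω hω
    simp [Urn.D, hX, (U.tau_spec n ω hω).1]
  have hbound : ∀ ω, ‖2 ^ α * L * X ω - M ω‖ ≤ ε * (L * y) + ε * (M ω ^ 2 / (L * y)) :=
    fun ω => hlin _
  have hbint : Integrable (fun ω => ε * (L * y) + ε * (M ω ^ 2 / (L * y))) μ :=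
    (integrable_const _).add ((hM2int.div_const _).const_mul _)
  have hdiff : Integrable (fun ω => 2 ^ α * L * X ω - M ω) μ :=
    hbint.mono' (((hmeas.sub aestronglyMeasurable_const).const_mul _).sub
      hMint.aestronglyMeasurable) (ae_of_all _ hbound)
  have hint : 2 ^ α * L * ∫ ω, X ω ∂μ = ∫ ω, (2 ^ α * L * X ω - M ω) ∂μ := by
    have h1 : ∫ ω, 2 ^ α * L * X ω ∂μ = ∫ ω, ((2 ^ α * L * X ω - M ω) + M ω) ∂μ := by simp
    rw [← integral_const_mul, h1, integral_add hdiff hMint, hM0, add_zero]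
  have hle : |2 ^ α * L * ∫ ω, X ω ∂μ| ≤ ε * (1 + T) * (L * y) := by
    rw [hint]
    calc |∫ ω, (2 ^ α * L * X ω - M ω) ∂μ|
        ≤ ∫ ω, (ε * (L * y) + ε * (M ω ^ 2 / (L * y))) ∂μ :=
          norm_integral_le_of_norm_le hbint (ae_of_all _ hbound)
      _ = ε * (L * y) + ε * ((∫ ω, M ω ^ 2 ∂μ) / (L * y)) := by
          rw [integral_add (integrable_const _) ((hM2int.div_const _).const_mul _),
            integral_const_mul ε fun ω => (invSum r (U.Re (U.tau n ω) ω) - invSum b n) ^ 2 / (L * y),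
            integral_div]
          simp [hM]
      _ ≤ ε * (L * y) + ε * (T * (L * y) * (L * y) / (L * y)) := by gcongr
      _ = _ := by field_simp
  rw [integral_congr_ae hDX, Real.dist_eq, sub_zero, abs_div, abs_of_pos hy0, div_lt_iff₀ hy0]
  rw [abs_mul, abs_of_pos (by positivity : 0 < 2 ^ α * L)] at hle
  have hεT : ε * (1 + T) = η / 2 * 2 ^ α := by rw [hε]; field_simp
  rw [hεT] at hle
  have hle' : 2 ^ α * L * |∫ ω, X ω ∂μ| ≤ 2 ^ α * L * (η / 2 * y) := by linarith
  have := le_of_mul_le_mul_left hle' (by positivity)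
  nlinarith
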